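/- arXiv:1005.1458 — 2 statements merged into one kernel-verified Lean document; each statement's English description precedes it below -/
import Mathlib

section
/- Let Ψ₀(y) = (2πy - 1)·e^{-πy} and Ψ(y) = ∑_{m=1}^∞ Ψ₀(m²y). Then for every z in the upper half plane, ∑_{γ ∈ Γ_∞\Γ} Ψ(Im(γ·z)^{-1}) = 1/2, where Γ = PSL₂(ℤ) acts on the upper half plane by fractional linear transformations and Γ_∞ is the stabilizer of ∞ generated by z ↦ z + 1. -/
open scoped UpperHalfPlane

/-- Ψ₀(y) = (2πy - 1)e^{-πy} -/
noncomputable def Psi0 (y : ℝ) : ℝ := (2 * Real.pi * y - 1) * Real.exp (-Real.pi * y)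

/-- Ψ(y) = ∑_{m ≥ 1} Ψ₀(m²y) -/
noncomputable def Psi (y : ℝ) : ℝ := ∑' m : ℕ+, Psi0 ((m : ℝ)^2 * y)

/-- The stabilizer of ∞ in PSL₂(ℤ), modelled in SL₂(ℤ) as the subgroup generated by
`T : z ↦ z + 1` and `-1`. -/
def GammaInf : Subgroup (Matrix.SpecialLinearGroup (Fin 2) ℤ) :=
  Subgroup.closure {ModularGroup.T, -1}

open Real Filter Topology

/-- The quadratic form `(c, d) ↦ |cz + d|² / Im z` of discriminant `-4`. -/
noncomputable def latticeForm (z : ℍ) (v : Fin 2 → ℤ) : ℝ :=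
  Complex.normSq (v 0 * (z : ℂ) + v 1) / z.im

lemma latticeForm_eq (z : ℍ) (v : Fin 2 → ℤ) :
    latticeForm z v = (v 0) ^ 2 * z.im + (v 0 * z.re + v 1) ^ 2 / z.im := by
  have := z.im_pos
  simp only [latticeForm, Complex.normSq_apply]
  simp
  field_simp
  ring

lemma latticeForm_smul (z : ℍ) (k : ℤ) (v : Fin 2 → ℤ) :
    latticeForm z (k • v) = (k : ℝ) ^ 2 * latticeForm z v := by
  simp only [latticeForm_eq, Pi.smul_apply, smul_eq_mul, Int.cast_mul]
  ring

lemma latticeForm_zero (z : ℍ) : latticeForm z 0 = 0 := by simp [latticeForm]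

lemma latticeForm_nonneg (z : ℍ) (v : Fin 2 → ℤ) : 0 ≤ latticeForm z v :=
  div_nonneg (Complex.normSq_nonneg _) z.im_pos.le

lemma sq_norm_le_latticeForm (z : ℍ) {v : Fin 2 → ℤ} (hv : v ≠ 0) :
    EisensteinSeries.r z ^ 2 / z.im * ‖v‖ ^ 2 ≤ latticeForm z v := by
  have h := EisensteinSeries.r_mul_max_le z hv
  have hr := EisensteinSeries.r_pos z
  have := z.im_pos
  rw [latticeForm, Complex.normSq_eq_norm_sq, div_mul_eq_mul_div, ← mul_pow]
  gcongr

lemma summable_comp_latticeForm (z : ℍ) {g : ℝ → ℝ} {C : ℝ}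
    (hg : ∀ u, 0 < u → |g u| * u ^ 2 ≤ C) :
    Summable fun v ↦ g (latticeForm z v) := by
  have hk : 0 < EisensteinSeries.r z ^ 2 / z.im := by
    have := EisensteinSeries.r_pos z
    have := z.im_pos
    positivity
  have hs := (EisensteinSeries.summable_one_div_norm_rpow (k := 4) (by norm_num)).mul_left
    (C / (EisensteinSeries.r z ^ 2 / z.im) ^ 2)
  refine hs.of_norm_bounded_eventually ?_
  filter_upwards [(Set.finite_singleton (0 : Fin 2 → ℤ)).compl_mem_cofinite] with v hv
  have hv' : v ≠ 0 := hv
  have h := sq_norm_le_latticeForm z hv'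
  set k := EisensteinSeries.r z ^ 2 / z.im
  have hn : 0 < ‖v‖ := norm_pos_iff.mpr hv'
  have hpos : 0 < k * ‖v‖ ^ 2 := by positivity
  have h4 : ‖v‖ ^ (-4 : ℝ) = (‖v‖ ^ 4)⁻¹ := by
    rw [rpow_neg hn.le]; norm_cast
  rw [h4, Real.norm_eq_abs, ← div_eq_mul_inv, div_div, le_div_iff₀ (by positivity)]
  refine le_trans ?_ (hg _ (hpos.trans_le h))
  have : k ^ 2 * ‖v‖ ^ 4 = (k * ‖v‖ ^ 2) ^ 2 := by ring
  rw [this]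
  gcongr

lemma summable_exp_latticeForm (z : ℍ) {s : ℝ} (hs : 0 < s) :
    Summable fun v ↦ exp (-(s * latticeForm z v)) := by
  refine summable_comp_latticeForm z (g := fun u ↦ exp (-(s * u))) (C := 2 / s ^ 2) fun u hu ↦ ?_
  have h := pow_div_factorial_le_exp (s * u) (by positivity) 2
  rw [abs_of_pos (exp_pos _), exp_neg, le_div_iff₀ (by positivity), inv_mul_eq_div,
    div_mul_eq_mul_div, div_le_iff₀ (exp_pos _)]
  simp [Nat.factorial] at h
  linarith [h, mul_pow s u 2]

lemma summable_latticeForm_mul_exp (z : ℍ) {s : ℝ} (hs : 0 < s) :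
    Summable fun v ↦ latticeForm z v * exp (-(s * latticeForm z v)) := by
  refine summable_comp_latticeForm z (g := fun u ↦ u * exp (-(s * u))) (C := 6 / s ^ 3)
    fun u hu ↦ ?_
  have h := pow_div_factorial_le_exp (s * u) (by positivity) 3
  rw [abs_of_pos (by positivity), exp_neg, le_div_iff₀ (by positivity), ← div_eq_mul_inv,
    div_mul_eq_mul_div, div_mul_eq_mul_div, div_le_iff₀ (exp_pos _)]
  simp [Nat.factorial] at h
  linarith [h, mul_pow s u 3]

/-- The theta series of `latticeForm`. -/
noncomputable def latticeTheta (z : ℍ) (t : ℝ) : ℝ := ∑' v, exp (-(π * t * latticeForm z v))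

/-- The terms of the theta series after Poisson summation in one of the two variables. -/
noncomputable def dualTerm (z : ℍ) (t : ℝ) (p : ℤ × ℤ) : ℂ :=
  Complex.exp (-(π * t * z.im * p.1 ^ 2) - π * z.im / t * p.2 ^ 2 -
    2 * π * Complex.I * p.1 * p.2 * z.re)

lemma summable_dualTerm (z : ℍ) {t : ℝ} (ht : 0 < t) : Summable (dualTerm z t) := by
  let w : ℍ := ⟨⟨0, t⟩, ht⟩
  have hre : w.re = 0 := rfl
  have him : w.im = t := rfl
  have h := (finTwoArrowEquiv ℤ).symm.summable_iff.mpr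
    (summable_exp_latticeForm w (s := π * z.im) (mul_pos pi_pos z.im_pos))
  refine Summable.of_norm (h.congr fun p ↦ ?_)
  simp only [Function.comp_apply, dualTerm, Complex.norm_exp, latticeForm_eq, hre, him]
  congr 1
  have e : (-(π * t * z.im * p.1 ^ 2) - π * z.im / t * p.2 ^ 2 -
    2 * π * Complex.I * p.1 * p.2 * z.re : ℂ) =
    ((-(π * t * z.im * p.1 ^ 2) - π * z.im / t * p.2 ^ 2 : ℝ) : ℂ) +
     ((-(2 * π * p.1 * p.2 * z.re) : ℝ) : ℂ) * Complex.I := by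
    push_cast; ring
  rw [e, Complex.add_re, Complex.ofReal_re, Complex.re_ofReal_mul, Complex.I_re]
  simp
  ring

lemma tsum_row_eq (z : ℍ) {t : ℝ} (ht : 0 < t) (c : ℤ) :
    ∑' d : ℤ, (exp (-(π * t * latticeForm z ![c, d])) : ℂ) =
      √(z.im / t) * ∑' n : ℤ, dualTerm z t (c, n) := by
  have hy := z.im_pos
  have ha : 0 < z.im / t := div_pos hy ht
  have hP := Complex.tsum_exp_neg_quadratic (a := ((z.im / t : ℝ) : ℂ)) (by simpa using ha)
    (-Complex.I * c * z.re)
  have hsq : (((z.im / t : ℝ) : ℂ) ^ (1 / 2 : ℂ)) = √(z.im / t) := by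
    rw [Real.sqrt_eq_rpow, Complex.ofReal_cpow ha.le]
    norm_num
  have hne : ((√(z.im / t) : ℝ) : ℂ) ≠ 0 := by
    exact_mod_cast (Real.sqrt_pos.mpr ha).ne'
  have hyc : (z.im : ℂ) ≠ 0 := by exact_mod_cast hy.ne'
  have htc : (t : ℂ) ≠ 0 := by exact_mod_cast ht.ne'
  have hI : Complex.I ^ 2 = -1 := Complex.I_sq
  have h1 : ∀ d : ℤ, (exp (-(π * t * latticeForm z ![c, d])) : ℂ) =
      Complex.exp (-(π * t * z.im * c ^ 2)) * Complex.exp (-π / ((z.im / t : ℝ) : ℂ) *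
        (d + Complex.I * (-Complex.I * c * z.re)) ^ 2) := fun d ↦ by
    have h2 : (d + Complex.I * (-Complex.I * c * z.re) : ℂ) = c * z.re + d := by
      linear_combination (-c * z.re : ℂ) * hI
    rw [h2, ← Complex.exp_add, Complex.ofReal_exp, latticeForm_eq]
    congr 1
    simp only [Matrix.cons_val_zero, Matrix.cons_val_one]
    push_cast
    field_simp
    ring
  have h3 : ∀ n : ℤ, dualTerm z t (c, n) = Complex.exp (-(π * t * z.im * c ^ 2)) *
      Complex.exp (-π * ((z.im / t : ℝ) : ℂ) * n ^ 2 + 2 * π * (-Complex.I * c * z.re) * n) :=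
    fun n ↦ by
    rw [dualTerm, ← Complex.exp_add]
    congr 1
    push_cast
    ring
  simp_rw [h1, h3, tsum_mul_left]
  rw [hP, hsq]
  field_simp

lemma latticeTheta_eq_dual (z : ℍ) {t : ℝ} (ht : 0 < t) :
    (latticeTheta z t : ℂ) = √(z.im / t) * ∑' p, dualTerm z t p := by
  have hs : Summable fun v ↦ (exp (-(π * t * latticeForm z v)) : ℂ) :=
    Complex.ofRealCLM.summable (summable_exp_latticeForm z (mul_pos pi_pos ht))
  rw [latticeTheta, Complex.ofReal_tsum, ← (finTwoArrowEquiv ℤ).symm.tsum_eq,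
    (summable_dualTerm z ht).tsum_prod, ← tsum_mul_left]
  refine (Summable.tsum_prod ((finTwoArrowEquiv ℤ).symm.summable_iff.mpr hs)).trans ?_
  exact tsum_congr fun c ↦ tsum_row_eq z ht c

lemma latticeTheta_inv (z : ℍ) {t : ℝ} (ht : 0 < t) :
    latticeTheta z t⁻¹ = t * latticeTheta z t := by
  have h1 := latticeTheta_eq_dual z ht
  have h2 := latticeTheta_eq_dual z (inv_pos.mpr ht)
  have h3 : ∑' p, dualTerm z t⁻¹ p = ∑' p, dualTerm z t p := by
    rw [← (Equiv.prodComm ℤ ℤ).tsum_eq]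
    refine tsum_congr fun p ↦ ?_
    simp only [dualTerm, Equiv.prodComm_apply, Prod.fst_swap, Prod.snd_swap]
    congr 1
    push_cast
    field_simp
    ring
  have h4 : √(z.im / t⁻¹) = t * √(z.im / t) := by
    rw [show z.im / t⁻¹ = t ^ 2 * (z.im / t) by field_simp, Real.sqrt_mul (by positivity),
      Real.sqrt_sq ht.le]
  rw [h3, h4, Complex.ofReal_mul, mul_assoc, ← h1] at h2
  exact_mod_cast h2

lemma hasDerivAt_latticeTheta (z : ℍ) :
    HasDerivAt (latticeTheta z)
      (∑' v, -(π * latticeForm z v) * exp (-(π * 1 * latticeForm z v))) 1 := by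
  refine hasDerivAt_tsum_of_isPreconnected (t := Set.Ioi (1 / 2 : ℝ)) (y₀ := 1)
    (g := fun v t ↦ exp (-(π * t * latticeForm z v)))
    (g' := fun v t ↦ -(π * latticeForm z v) * exp (-(π * t * latticeForm z v)))
    ((summable_latticeForm_mul_exp z (s := π / 2) (by positivity)).mul_left π)
    isOpen_Ioi isPreconnected_Ioi (fun v t _ ↦ ?_) (fun v t ht ↦ ?_) (by norm_num) ?_ (by norm_num)
  · have h : HasDerivAt (fun t : ℝ ↦ -(π * t * latticeForm z v)) (-(π * latticeForm z v)) t := by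
      simpa using (((hasDerivAt_id' t).const_mul π).mul_const (latticeForm z v)).fun_neg
    simpa [mul_comm] using h.exp
  · have hQ := latticeForm_nonneg z v
    rw [norm_mul, norm_neg, Real.norm_of_nonneg (by positivity), Real.norm_of_nonneg (by positivity),
      mul_assoc]
    have ht' : 1 / 2 ≤ t := le_of_lt ht
    gcongr
    rw [div_eq_mul_one_div]
    gcongr
  · exact summable_exp_latticeForm z (by positivity)

lemma hasSum_Psi0_latticeForm (z : ℍ) :
    HasSum (fun v ↦ Psi0 (latticeForm z v)) 0 := by
  have hD := hasDerivAt_latticeTheta z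
  set D := ∑' v, -(π * latticeForm z v) * exp (-(π * 1 * latticeForm z v)) with hDdef
  have hl : HasDerivAt (fun t ↦ latticeTheta z t⁻¹) (-D) 1 := by
    have hi : HasDerivAt (fun t : ℝ ↦ t⁻¹) (-1) 1 := by
      simpa using hasDerivAt_inv (one_ne_zero (α := ℝ))
    have hD' : HasDerivAt (latticeTheta z) D (1 : ℝ)⁻¹ := by simpa using hD
    simpa [Function.comp_def] using hD'.comp 1 hi
  have hr : HasDerivAt (fun t ↦ t * latticeTheta z t) (latticeTheta z 1 + D) 1 := by
    simpa using (hasDerivAt_id' (1 : ℝ)).fun_mul hD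
  have he : (fun t ↦ latticeTheta z t⁻¹) =ᶠ[𝓝 1] fun t ↦ t * latticeTheta z t := by
    filter_upwards [lt_mem_nhds (zero_lt_one (α := ℝ))] with t ht using latticeTheta_inv z ht
  have key := hl.unique (hr.congr_of_eventuallyEq he)
  have s1 := (summable_exp_latticeForm z (s := π * 1) (by positivity)).hasSum
  have s2 : HasSum (fun v ↦ -(π * latticeForm z v) * exp (-(π * 1 * latticeForm z v))) D :=
    (((summable_latticeForm_mul_exp z (s := π * 1) (by positivity)).mul_left (-π)).congr
      fun v ↦ by ring).hasSum
  have h := (s2.mul_left (-2)).sub s1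
  change HasSum _ (-2 * D - latticeTheta z 1) at h
  rw [show -2 * D - latticeTheta z 1 = 0 by linarith] at h
  refine h.congr_fun ?_
  intro v
  rw [Psi0]
  ring_nf

lemma hasSum_Psi0_latticeForm_ne_zero (z : ℍ) :
    HasSum (fun v : {v : Fin 2 → ℤ // v ≠ 0} ↦ Psi0 (latticeForm z v)) 1 := by
  have h := hasSum_ite_sub_hasSum (hasSum_Psi0_latticeForm z) 0
  have h0 : (0 : ℝ) - Psi0 (latticeForm z 0) = 1 := by simp [latticeForm_zero, Psi0]
  rw [h0] at h
  refine (hasSum_subtype_iff_indicator (s := {v : Fin 2 → ℤ | v ≠ 0})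
    (f := fun v ↦ Psi0 (latticeForm z v)) (a := (1 : ℝ))).mpr (h.congr_fun fun v ↦ ?_)
  by_cases hv : v = 0 <;> simp [hv]

open ModularGroup Matrix in
lemma mem_GammaInf_iff (g : SpecialLinearGroup (Fin 2) ℤ) : g ∈ GammaInf ↔ g 1 0 = 0 := by
  constructor
  · intro hg
    induction hg using Subgroup.closure_induction with
    | mem x hx =>
      rcases hx with rfl | rfl
      · simp [T]
      · simp
    | one => simp
    | mul x y _ _ hx hy => simp [Matrix.mul_apply, Fin.sum_univ_two, hx, hy]
    | inv x _ hx => simp [SpecialLinearGroup.SL2_inv_expl, hx]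
  · intro hc
    have hT (n : ℤ) : T ^ n ∈ GammaInf :=
      zpow_mem (Subgroup.subset_closure (by simp)) n
    have hneg : (-1 : SpecialLinearGroup (Fin 2) ℤ) ∈ GammaInf :=
      Subgroup.subset_closure (by simp)
    have had : g 0 0 * g 1 1 = 1 := by
      have := g.det_coe
      rw [det_fin_two, hc] at this; lia
    rcases Int.eq_one_or_neg_one_of_mul_eq_one' had with (⟨ha, hd⟩ | ⟨ha, hd⟩)
    · have : g = T ^ g 0 1 := by
        ext i j; fin_cases i <;> fin_cases j <;> simp [ha, hc, hd, coe_T_zpow]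
      rw [this]; exact hT _
    · have : g = -1 * T ^ (-(g 0 1)) := by
        ext i j; fin_cases i <;> fin_cases j <;> simp [ha, hc, hd, coe_T_zpow]
      rw [this]; exact mul_mem hneg (hT _)

open Matrix in
lemma rightRel_GammaInf_iff (g h : SpecialLinearGroup (Fin 2) ℤ) :
    QuotientGroup.rightRel GammaInf g h ↔ h 1 0 * g 1 1 = h 1 1 * g 1 0 := by
  have hm : (h * g⁻¹) 1 0 = h 1 0 * g 1 1 - h 1 1 * g 1 0 := by
    rw [Matrix.SpecialLinearGroup.coe_mul, Matrix.SpecialLinearGroup.coe_inv, adjugate_fin_two,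
      Matrix.mul_apply, Fin.sum_univ_two]
    simp
    ring
  rw [QuotientGroup.rightRel_apply, mem_GammaInf_iff, hm, sub_eq_zero]

open Matrix in
lemma exists_unit_smul_row_of_rightRel {g h : SpecialLinearGroup (Fin 2) ℤ}
    (hr : QuotientGroup.rightRel GammaInf g h) : ∃ ε : ℤˣ, h 1 = (ε : ℤ) • g 1 := by
  rw [QuotientGroup.rightRel_apply, mem_GammaInf_iff] at hr
  set k := h * g⁻¹ with hk
  have hh : h = k * g := by simp [hk]
  have had : k 0 0 * k 1 1 = 1 := by
    have := k.det_coe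
    rw [det_fin_two, hr] at this; lia
  refine ⟨⟨k 1 1, k 0 0, by rw [mul_comm, had], had⟩, ?_⟩
  rw [hh]
  ext j
  simp [Matrix.mul_apply, Fin.sum_univ_two, hr]

/-- The nonzero vector attached to a sign, a coset of `GammaInf` and a positive integer. -/
noncomputable def cosetVector (p : ℤˣ × Quotient (QuotientGroup.rightRel GammaInf) × ℕ+) :
    Fin 2 → ℤ :=
  ((p.1 : ℤ) * (p.2.2 : ℕ)) • (Quotient.out p.2.1) 1

open Matrix in
lemma row_one_ne_zero (g : SpecialLinearGroup (Fin 2) ℤ) : g 1 ≠ 0 := by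
  intro h
  have := g.det_coe
  rw [det_fin_two, show g 1 0 = 0 from congrFun h 0, show g 1 1 = 0 from congrFun h 1] at this
  simp at this

lemma cosetVector_ne_zero (p) : cosetVector p ≠ 0 :=
  smul_ne_zero (mul_ne_zero p.1.ne_zero (by simp)) (row_one_ne_zero _)

lemma cosetVector_injective : Function.Injective cosetVector := by
  rintro ⟨ε, q, m⟩ ⟨ε', q', m'⟩ h
  have hk : ((ε : ℤ) * (m : ℕ)) ≠ 0 := mul_ne_zero ε.ne_zero (by simp)
  have hk' : ((ε' : ℤ) * (m' : ℕ)) ≠ 0 := mul_ne_zero ε'.ne_zero (by simp)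
  simp only [cosetVector] at h
  obtain rfl : q = q' := by
    rw [← Quotient.out_equiv_out]
    refine (rightRel_GammaInf_iff _ _).mpr ?_
    have h0 := congrFun h 0
    have h1 := congrFun h 1
    simp only [Pi.smul_apply, smul_eq_mul] at h0 h1
    apply mul_left_cancel₀ (mul_ne_zero hk hk')
    grind
  have hm := smul_left_injective ℤ (row_one_ne_zero (Quotient.out q)) h
  have hm' : m = m' := by
    have := congrArg Int.natAbs hm
    simp only [Int.natAbs_mul, Int.natAbs_natCast, Int.units_natAbs, one_mul] at this
    exact_mod_cast this
  subst hm'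
  have : ε = ε' := Units.ext (mul_right_cancel₀ (by simp) hm)
  rw [this]

lemma exists_cosetVector_eq {v : Fin 2 → ℤ} (hv : v ≠ 0) : ∃ p, cosetVector p = v := by
  have hne : v 0 ≠ 0 ∨ v 1 ≠ 0 := by
    by_contra! h
    exact hv (by ext i; fin_cases i <;> simp [h.1, h.2])
  have hpos : 0 < Int.gcd (v 0) (v 1) := Int.gcd_pos_iff.mpr hne
  obtain ⟨a, b, hab, ha, hb⟩ := Int.exists_gcd_one hpos
  obtain ⟨g, -, hg⟩ := ModularGroup.bottom_row_surj (R := ℤ) (a := ![a, b])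
    (by simpa using Int.isCoprime_iff_gcd_eq_one.mpr hab)
  have hr : QuotientGroup.rightRel GammaInf
      (Quotient.out (Quotient.mk (QuotientGroup.rightRel GammaInf) g)) g :=
    Quotient.mk_out (s := QuotientGroup.rightRel GammaInf) g
  obtain ⟨ε, hε⟩ := exists_unit_smul_row_of_rightRel hr
  refine ⟨⟨ε, Quotient.mk _ g, ⟨_, hpos⟩⟩, ?_⟩
  have hg' : (g : Matrix (Fin 2) (Fin 2) ℤ) 1 = ![a, b] := hg
  simp only [cosetVector, PNat.mk_coe]
  rw [mul_comm, mul_smul]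
  erw [← hε]
  rw [hg']
  ext i
  fin_cases i
  · simp [mul_comm]; linarith
  · simp [mul_comm]; linarith

/-- Nonzero integer vectors are parametrised by a sign, a coset and a positive integer. -/
noncomputable def cosetVectorEquiv :
    ℤˣ × Quotient (QuotientGroup.rightRel GammaInf) × ℕ+ ≃ {v : Fin 2 → ℤ // v ≠ 0} :=
  Equiv.ofBijective (fun p ↦ ⟨cosetVector p, cosetVector_ne_zero p⟩)
    ⟨fun _ _ h ↦ cosetVector_injective (congrArg Subtype.val h),
      fun v ↦ (exists_cosetVector_eq v.2).imp fun _ h ↦ Subtype.ext h⟩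

lemma inv_im_smul (g : Matrix.SpecialLinearGroup (Fin 2) ℤ) (z : ℍ) :
    (g • z).im⁻¹ = latticeForm z (g 1) := by
  rw [ModularGroup.im_smul_eq_div_normSq, inv_div, ModularGroup.denom_apply, latticeForm]

lemma latticeForm_cosetVector (z : ℍ)
    (p : ℤˣ × Quotient (QuotientGroup.rightRel GammaInf) × ℕ+) :
    latticeForm z (cosetVector p) =
      (p.2.2 : ℝ) ^ 2 * (Quotient.out p.2.1 • z).im⁻¹ := by
  rw [cosetVector, latticeForm_smul, inv_im_smul]
  rcases Int.units_eq_one_or p.1 with h | h <;> simp [h]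

/-- For every `z` in the upper half plane, `∑_{γ ∈ Γ_∞\Γ} Ψ(Im(γ·z)⁻¹) = 1/2`. -/
theorem sum_Psi_eq_half (z : ℍ) :
    ∑' q : Quotient (QuotientGroup.rightRel GammaInf),
      Psi ((UpperHalfPlane.im ((Quotient.out q) • z))⁻¹) = 1/2 := by
  have h := (cosetVectorEquiv.hasSum_iff (a := 1)).mpr (hasSum_Psi0_latticeForm_ne_zero z)
  have hf : ((fun v : {v : Fin 2 → ℤ // v ≠ 0} ↦ Psi0 (latticeForm z v)) ∘ cosetVectorEquiv) =
      fun p ↦ Psi0 ((p.2.2 : ℝ) ^ 2 * (Quotient.out p.2.1 • z).im⁻¹) :=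
    funext fun p ↦ congrArg Psi0 (latticeForm_cosetVector z p)
  rw [hf] at h
  have h1 := h.summable.tsum_prod
  have h2 := (h.summable.prod_factor 1).tsum_prod
  simp only [tsum_fintype, Finset.sum_const, Finset.card_univ, Fintype.card_units_int, h.tsum_eq] at h1
  simp only [Psi]
  rw [← h2]
  simp at h1 ⊢
  linarith
end

section
/- Write β = σ_B + iτ_B and γ = σ_C + iτ_C with σ_B, σ_C > 0. For |τ_B| > 1, the ratio of Gamma functions satisfies Γ(β/2)·Γ(γ/2 + 1)/Γ((β+γ)/2 + 1) ≪_{σ_B, σ_C} (1 + |τ_C|^{(1+σ_C)/2})/|τ_B|^{1 + σ_C/2}. -/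
open Complex

/-- For fixed `t`, the function `x ↦ log (x / |x + it|)` is concave on the positive reals. -/
lemma concaveOn_log_sub_log_norm (t : ℝ) :
    ConcaveOn ℝ (Set.Ioi 0) fun x : ℝ => Real.log x - Real.log ‖(x : ℂ) + t * I‖ := by
  have hlog : (fun x : ℝ => Real.log x - Real.log ‖(x : ℂ) + t * I‖) =
      fun x : ℝ => Real.log x - Real.log (x ^ 2 + t ^ 2) / 2 := by
    funext x
    rw [norm_add_mul_I, Real.log_sqrt (by positivity)]
  have hderiv : ∀ x ∈ Set.Ioi (0 : ℝ),
      HasDerivAt (fun x : ℝ => Real.log x - Real.log (x ^ 2 + t ^ 2) / 2)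
        (t ^ 2 / (x * (x ^ 2 + t ^ 2))) x := by
    intro x hx
    have hx : 0 < x := hx
    have hq : x ^ 2 + t ^ 2 ≠ 0 := by positivity
    refine ((Real.hasDerivAt_log hx.ne').sub
      ((((hasDerivAt_pow 2 x).add_const (t ^ 2)).log hq).div_const 2)).congr_deriv ?_
    field_simp
    norm_num
    ring
  rw [hlog]
  refine AntitoneOn.concaveOn_of_deriv (convex_Ioi 0)
    (fun x hx => (hderiv x hx).continuousAt.continuousWithinAt)
    (fun x hx => (hderiv x (interior_subset hx)).differentiableAt.differentiableWithinAt) ?_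
  rw [interior_Ioi]
  intro x hx y hy hxy
  have hx : 0 < x := hx
  have hy : 0 < y := hy
  rw [(hderiv x hx).deriv, (hderiv y hy).deriv]
  gcongr

lemma log_norm_GammaSeq_sub_log_GammaSeq (t : ℝ) {x : ℝ} (hx : 0 < x) {n : ℕ} (hn : n ≠ 0) :
    Real.log ‖GammaSeq (x + t * I) n‖ - Real.log (Real.GammaSeq x n) =
      ∑ j ∈ Finset.range (n + 1),
        (Real.log (x + j) - Real.log ‖((x + j : ℝ) : ℂ) + t * I‖) := by
  have hn' : (0 : ℝ) < n := by positivity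
  have hre : ∀ j : ℕ, ‖((x + j : ℝ) : ℂ) + t * I‖ ≠ 0 := fun j h => by
    have := congrArg re (norm_eq_zero.mp h)
    simp at this
    linarith [j.cast_nonneg (α := ℝ)]
  have hpow : ‖(n : ℂ) ^ ((x : ℂ) + t * I)‖ = (n : ℝ) ^ x := by
    rw [norm_natCast_cpow_of_pos (by omega)]
    simp
  have hnorm : ‖GammaSeq (x + t * I) n‖ = (n : ℝ) ^ x * n.factorial /
      ∏ j ∈ Finset.range (n + 1), ‖((x + j : ℝ) : ℂ) + t * I‖ := by
    rw [GammaSeq, norm_div, norm_mul, hpow, norm_prod, Complex.norm_natCast]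
    congr 1
    refine Finset.prod_congr rfl fun j _ => ?_
    congr 1
    push_cast
    ring
  have hnum : (n : ℝ) ^ x * n.factorial ≠ 0 := by positivity
  rw [hnorm, Real.GammaSeq, Real.log_div hnum (Finset.prod_ne_zero_iff.mpr fun j _ => hre j),
    Real.log_div hnum (Finset.prod_ne_zero_iff.mpr fun j _ => by positivity),
    Real.log_prod fun j _ => hre j, Real.log_prod fun j _ => by positivity,
    Finset.sum_sub_distrib]
  ring

lemma Gamma_ofReal_add_mul_I_ne_zero (t : ℝ) {x : ℝ} (hx : 0 < x) :
    Gamma (x + t * I) ≠ 0 :=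
  Gamma_ne_zero_of_re_pos (by simpa using hx)

/-- For fixed `t`, the function `x ↦ log (|Γ(x + it)| / Γ(x))` is concave on the positive reals. -/
lemma concaveOn_log_norm_Gamma_sub_log_Gamma (t : ℝ) :
    ConcaveOn ℝ (Set.Ioi 0) fun x : ℝ =>
      Real.log ‖Gamma (x + t * I)‖ - Real.log (Real.Gamma x) := by
  have hlim : ∀ x ∈ Set.Ioi (0 : ℝ), Filter.Tendsto
      (fun n : ℕ => ∑ j ∈ Finset.range (n + 1),
        (Real.log (x + j) - Real.log ‖((x + j : ℝ) : ℂ) + t * I‖)) Filter.atTop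
      (nhds (Real.log ‖Gamma (x + t * I)‖ - Real.log (Real.Gamma x))) := by
    intro x hx
    have hlog := ((GammaSeq_tendsto_Gamma (x + t * I)).norm.log
      (norm_ne_zero_iff.mpr (Gamma_ofReal_add_mul_I_ne_zero t hx))).sub
      ((Real.GammaSeq_tendsto_Gamma x).log (Real.Gamma_pos_of_pos hx).ne')
    refine hlog.congr' ?_
    filter_upwards [Filter.eventually_ne_atTop 0] with n hn
    exact log_norm_GammaSeq_sub_log_GammaSeq t hx hn
  refine ⟨convex_Ioi 0, fun x hx y hy a b ha hb hab => ?_⟩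
  refine le_of_tendsto_of_tendsto' (((hlim x hx).const_smul a).add ((hlim y hy).const_smul b))
    (hlim _ (convex_Ioi 0 hx hy ha hb hab)) fun n => ?_
  rw [Finset.smul_sum, Finset.smul_sum, ← Finset.sum_add_distrib]
  refine Finset.sum_le_sum fun j _ => ?_
  have hx : 0 < x := hx
  have hy : 0 < y := hy
  have hj : a • x + b • y + (j : ℝ) = a • (x + j) + b • (y + j) := by
    simp only [smul_eq_mul]
    linear_combination (-(j : ℝ)) * hab
  rw [hj]
  exact (concaveOn_log_sub_log_norm t).2 (show x + (j : ℝ) ∈ Set.Ioi (0 : ℝ) by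
    simp only [Set.mem_Ioi]; positivity) (show y + (j : ℝ) ∈ Set.Ioi (0 : ℝ) by
    simp only [Set.mem_Ioi]; positivity) ha hb hab

lemma norm_Gamma_one_half_add_mul_I_sq (t : ℝ) :
    ‖Gamma ((1 / 2 : ℝ) + t * I)‖ ^ 2 = Real.pi / Real.cosh (Real.pi * t) := by
  have hconj : 1 - (((1 / 2 : ℝ) : ℂ) + t * I) =
      (starRingEnd ℂ) (((1 / 2 : ℝ) : ℂ) + t * I) := by
    apply Complex.ext <;> norm_num
  have hsin : sin (Real.pi * (((1 / 2 : ℝ) : ℂ) + t * I)) = (Real.cosh (Real.pi * t) : ℝ) := by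
    have harg : (Real.pi : ℂ) * (((1 / 2 : ℝ) : ℂ) + t * I) =
        (Real.pi * t : ℂ) * I + Real.pi / 2 := by
      push_cast
      ring
    rw [harg, sin_add_pi_div_two, cos_mul_I]
    push_cast
    rfl
  have h := Gamma_mul_Gamma_one_sub (((1 / 2 : ℝ) : ℂ) + t * I)
  rw [hconj, Gamma_conj, mul_conj', hsin] at h
  exact_mod_cast h

/-- The logarithm of the quotient of `|Γ(x + it)|` by `(1 + |t|) ^ (x - 1/2) * exp (-π|t|/2)`. -/
noncomputable def logStirlingError (x t : ℝ) : ℝ :=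
  Real.log ‖Gamma (x + t * I)‖ - (x - 1 / 2) * Real.log (1 + |t|) + Real.pi / 2 * |t|

lemma abs_logStirlingError_one_half_le (t : ℝ) :
    |logStirlingError (1 / 2) t| ≤ (Real.log Real.pi + Real.log 2) / 2 := by
  have hcosh := Real.cosh_pos (Real.pi * t)
  have hlog : 2 * Real.log ‖Gamma ((1 / 2 : ℝ) + t * I)‖ =
      Real.log Real.pi - Real.log (Real.cosh (Real.pi * t)) := by
    rw [← Real.log_div Real.pi_pos.ne' hcosh.ne', ← norm_Gamma_one_half_add_mul_I_sq,
      Real.log_pow]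
    norm_num
  have habs : Real.pi * |t| = |Real.pi * t| := by
    rw [abs_mul, abs_of_pos Real.pi_pos]
  have hupper : Real.log (Real.cosh (Real.pi * t)) ≤ Real.pi * |t| := by
    rw [habs, Real.log_le_iff_le_exp hcosh, ← Real.cosh_abs, Real.cosh_eq]
    have : Real.exp (-|Real.pi * t|) ≤ Real.exp |Real.pi * t| :=
      Real.exp_le_exp.mpr (by linarith [abs_nonneg (Real.pi * t)])
    linarith
  have hlower : Real.pi * |t| - Real.log 2 ≤ Real.log (Real.cosh (Real.pi * t)) := by
    rw [habs, Real.le_log_iff_exp_le hcosh, Real.exp_sub, Real.exp_log two_pos,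
      ← Real.cosh_abs, Real.cosh_eq]
    linarith [Real.exp_pos (-|Real.pi * t|)]
  have hpi : 0 < Real.log Real.pi := Real.log_pos (by linarith [Real.pi_gt_three])
  have htwo : 0 < Real.log 2 := Real.log_pos one_lt_two
  rw [logStirlingError, abs_le]
  constructor <;> linarith

lemma abs_logStirlingError_add_one_sub_le {x : ℝ} (hx : 0 < x) (t : ℝ) :
    |logStirlingError (x + 1) t - logStirlingError x t| ≤ |Real.log x| + Real.log 2 + x := by
  set s : ℂ := x + t * I with hs
  have hs0 : s ≠ 0 := fun h => hx.ne' (by simpa [hs] using congrArg re h)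
  have hsn : 0 < ‖s‖ := norm_pos_iff.mpr hs0
  have hΓ : Gamma ((x + 1 : ℝ) + t * I) = s * Gamma s := by
    rw [← Gamma_add_one s hs0, hs]
    congr 1
    push_cast
    ring
  have hdiff : logStirlingError (x + 1) t - logStirlingError x t =
      Real.log ‖s‖ - Real.log (1 + |t|) := by
    rw [logStirlingError, logStirlingError, hΓ, norm_mul, Real.log_mul hsn.ne'
      (norm_ne_zero_iff.mpr (Gamma_ofReal_add_mul_I_ne_zero t hx))]
    ring
  have hre : x ≤ ‖s‖ := by simpa [hs] using re_le_norm s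
  have him : |t| ≤ ‖s‖ := by simpa [hs] using abs_im_le_norm s
  have ht := abs_nonneg t
  have htwo : 0 < Real.log 2 := Real.log_pos one_lt_two
  have hupper : Real.log ‖s‖ ≤ x + Real.log (1 + |t|) := by
    have hle : ‖s‖ ≤ (1 + x) * (1 + |t|) := by
      have := norm_add_le (x : ℂ) (t * I)
      simp only [norm_mul, norm_I, norm_real, Real.norm_eq_abs, mul_one, abs_of_pos hx] at this
      nlinarith [mul_nonneg hx.le ht]
    have hlog := Real.log_le_log hsn hle
    rw [Real.log_mul (by positivity) (by positivity)] at hlog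
    linarith [Real.log_le_sub_one_of_pos (show 0 < 1 + x by positivity)]
  have hlower : Real.log (1 + |t|) ≤ |Real.log x| + Real.log 2 + Real.log ‖s‖ := by
    rcases le_total |t| 1 with h1 | h1
    · have h2 := Real.log_le_log (by positivity) (show 1 + |t| ≤ 2 by linarith)
      linarith [Real.log_le_log hx hre, neg_abs_le (Real.log x)]
    · have h2 := Real.log_le_log (by positivity) (show 1 + |t| ≤ 2 * ‖s‖ by linarith)
      rw [Real.log_mul two_ne_zero hsn.ne'] at h2
      linarith [abs_nonneg (Real.log x)]
  rw [hdiff, abs_le]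
  constructor <;> linarith [abs_nonneg (Real.log x)]

lemma exists_abs_logStirlingError_add_one_le_iff {x : ℝ} (hx : 0 < x) :
    (∃ K, ∀ t, |logStirlingError (x + 1) t| ≤ K) ↔ ∃ K, ∀ t, |logStirlingError x t| ≤ K := by
  constructor <;> rintro ⟨K, hK⟩ <;>
    refine ⟨K + (|Real.log x| + Real.log 2 + x), fun t => ?_⟩ <;>
    have h := abs_le.mp (abs_logStirlingError_add_one_sub_le hx t) <;>
    have hKt := abs_le.mp (hK t) <;>
    rw [abs_le] <;> constructor <;> linarith

lemma concaveOn_logStirlingError_sub_log_Gamma (t : ℝ) :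
    ConcaveOn ℝ (Set.Ioi 0) fun x : ℝ => logStirlingError x t - Real.log (Real.Gamma x) := by
  refine ⟨convex_Ioi 0, fun x hx y hy a b ha hb hab => ?_⟩
  have h := (concaveOn_log_norm_Gamma_sub_log_Gamma t).2 hx hy ha hb hab
  simp only [logStirlingError, smul_eq_mul] at h ⊢
  linear_combination h + (1 / 2 * Real.log (1 + |t|) + Real.pi / 2 * |t|) * hab

lemma exists_abs_logStirlingError_le_of_mem_Icc {x : ℝ} (hx : x ∈ Set.Icc (3 / 2 : ℝ) (5 / 2)) :
    ∃ K, ∀ t, |logStirlingError x t| ≤ K := by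
  obtain ⟨K₁, h₁⟩ : ∃ K, ∀ t, |logStirlingError (1 / 2) t| ≤ K :=
    ⟨_, abs_logStirlingError_one_half_le⟩
  obtain ⟨K₂, h₂⟩ := (exists_abs_logStirlingError_add_one_le_iff (by norm_num)).mpr ⟨K₁, h₁⟩
  obtain ⟨K₃, h₃⟩ := (exists_abs_logStirlingError_add_one_le_iff (by norm_num)).mpr ⟨K₂, h₂⟩
  norm_num at h₂ h₃
  obtain ⟨hx₁, hx₂⟩ := hx
  set g₁ := Real.log (Real.Gamma (1 / 2))
  set g₂ := Real.log (Real.Gamma (3 / 2))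
  set g₃ := Real.log (Real.Gamma (5 / 2))
  set g := Real.log (Real.Gamma x)
  set M := K₁ + K₂ + K₃ + |g₁| + |g₂| + |g₃| with hM
  refine ⟨3 * M + |g|, fun t => ?_⟩
  have e₁ := abs_le.mp (h₁ t)
  have e₂ := abs_le.mp (h₂ t)
  have e₃ := abs_le.mp (h₃ t)
  have a₁ := abs_le.mp (le_refl |g₁|)
  have a₂ := abs_le.mp (le_refl |g₂|)
  have a₃ := abs_le.mp (le_refl |g₃|)
  have a := abs_le.mp (le_refl |g|)
  have hconc := concaveOn_logStirlingError_sub_log_Gamma t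
  set F : ℝ → ℝ := fun x => logStirlingError x t - Real.log (Real.Gamma x)
  have b₁ : |F (1 / 2)| ≤ M := by
    rw [abs_le]; constructor <;> simp only [F] <;> linarith
  have b₂ : |F (3 / 2)| ≤ M := by
    rw [abs_le]; constructor <;> simp only [F] <;> linarith
  have b₃ : |F (5 / 2)| ≤ M := by
    rw [abs_le]; constructor <;> simp only [F] <;> linarith
  have hlower : -M ≤ F x := by
    have h := hconc.min_le_of_mem_Icc (x := 3 / 2) (y := 5 / 2) (z := x)
      (by simp) (by simp) ⟨hx₁, hx₂⟩
    exact (le_min (abs_le.mp b₂).1 (abs_le.mp b₃).1).trans h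
  have hupper : F x ≤ 3 * M := by
    have hy : 0 < x - 1 / 2 := by linarith
    have hy' : x * 2 - 1 ≠ 0 := by linarith
    have h := hconc.2 (show (1 / 2 : ℝ) ∈ Set.Ioi (0 : ℝ) by simp)
      (show x ∈ Set.Ioi (0 : ℝ) by simp only [Set.mem_Ioi]; linarith)
      (show 0 ≤ (x - 3 / 2) / (x - 1 / 2) from div_nonneg (by linarith) hy.le)
      (show 0 ≤ 1 / (x - 1 / 2) by positivity) (by field_simp; ring)
    have hmid : ((x - 3 / 2) / (x - 1 / 2)) • (1 / 2 : ℝ) + (1 / (x - 1 / 2)) • x = 3 / 2 := by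
      simp only [smul_eq_mul]
      field_simp
      ring
    rw [hmid] at h
    simp only [smul_eq_mul] at h
    have h' : (x - 3 / 2) * F (1 / 2) + F x ≤ (x - 1 / 2) * F (3 / 2) := by
      have := mul_le_mul_of_nonneg_left h hy.le
      calc _ = (x - 1 / 2) * ((x - 3 / 2) / (x - 1 / 2) * F (1 / 2) + 1 / (x - 1 / 2) * F x) := by
            field_simp
        _ ≤ _ := this
    nlinarith [(abs_le.mp b₁).1, (abs_le.mp b₂).2, (abs_nonneg _).trans b₁]
  simp only [F] at hlower hupper
  have hM0 := (abs_nonneg _).trans b₁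
  rw [abs_le]
  constructor <;> linarith

/-- Stirling's bound `|Γ(x + it)| ≍ (1 + |t|) ^ (x - 1/2) * exp (-π|t|/2)`, in logarithmic form. -/
theorem exists_abs_logStirlingError_le {x : ℝ} (hx : 0 < x) :
    ∃ K, ∀ t, |logStirlingError x t| ≤ K := by
  have hlarge : ∀ n : ℕ, ∀ y ∈ Set.Icc (3 / 2 + n : ℝ) (5 / 2 + n),
      ∃ K, ∀ t, |logStirlingError y t| ≤ K := by
    intro n
    induction n with
    | zero =>
      intro y hy
      exact exists_abs_logStirlingError_le_of_mem_Icc (by simpa using hy)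
    | succ n ih =>
      rintro y ⟨hy₁, hy₂⟩
      push_cast at hy₁ hy₂
      have hn : (0 : ℝ) ≤ n := n.cast_nonneg
      have h := ih (y - 1) ⟨by linarith, by linarith⟩
      rw [← exists_abs_logStirlingError_add_one_le_iff (by linarith)] at h
      simpa using h
  have hxy : ∃ K, ∀ t, |logStirlingError (x + 1 + 1) t| ≤ K := by
    have h₁ := Nat.floor_le (show 0 ≤ x + 1 / 2 by linarith)
    have h₂ := Nat.lt_floor_add_one (x + 1 / 2)
    exact hlarge ⌊x + 1 / 2⌋₊ _ ⟨by linarith, by linarith⟩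
  rwa [exists_abs_logStirlingError_add_one_le_iff (by linarith),
    exists_abs_logStirlingError_add_one_le_iff hx] at hxy

lemma exists_mul_log_one_add_le {A : ℝ} (hA : 0 < A) :
    ∃ K, ∀ D, 0 ≤ D → A * Real.log (1 + D) ≤ K + Real.pi / 2 * D := by
  refine ⟨Real.pi / 2 - A * Real.log (Real.pi / (2 * A)), fun D hD => ?_⟩
  have hpi := Real.pi_pos
  have h := Real.log_le_sub_one_of_pos (show 0 < Real.pi / (2 * A) * (1 + D) by positivity)
  rw [Real.log_mul (by positivity) (by positivity)] at h
  have h' := mul_le_mul_of_nonneg_left h hA.le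
  have hcancel : A * (Real.pi / (2 * A) * (1 + D) - 1) = Real.pi / 2 * (1 + D) - A := by
    field_simp
  linarith

lemma exists_mul_log_one_add_abs_sub_le {A : ℝ} (hA : 0 < A) :
    ∃ K, ∀ b t, A * Real.log (1 + |b|) - A * Real.log (1 + |b + t|) ≤
      K + Real.pi / 2 * (|b| + |t| - |b + t|) := by
  obtain ⟨K, hK⟩ := exists_mul_log_one_add_le hA
  refine ⟨K, fun b t => ?_⟩
  have hD : 0 ≤ |b| + |t| - |b + t| := sub_nonneg.mpr (abs_add_le b t)
  have hle : 1 + |b| ≤ (1 + |b + t|) * (1 + (|b| + |t| - |b + t|)) := by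
    nlinarith [mul_nonneg (abs_nonneg (b + t)) hD, abs_nonneg t]
  have hlog := Real.log_le_log (by positivity) hle
  rw [Real.log_mul (by positivity) (by positivity)] at hlog
  have := mul_le_mul_of_nonneg_left hlog hA.le
  linarith [hK _ hD]

lemma one_add_rpow_le {x p : ℝ} (hx : 0 ≤ x) (hp : 0 ≤ p) :
    (1 + x) ^ p ≤ 2 ^ p * (1 + x ^ p) := by
  have hxp : 0 ≤ x ^ p := Real.rpow_nonneg hx p
  have h2p : (0 : ℝ) ≤ 2 ^ p := by positivity
  rcases le_total x 1 with h | h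
  · calc (1 + x) ^ p ≤ 2 ^ p := Real.rpow_le_rpow (by positivity) (by linarith) hp
      _ ≤ 2 ^ p * (1 + x ^ p) := by nlinarith
  · calc (1 + x) ^ p ≤ (2 * x) ^ p := Real.rpow_le_rpow (by positivity) (by linarith) hp
      _ = 2 ^ p * x ^ p := Real.mul_rpow two_pos.le hx
      _ ≤ 2 ^ p * (1 + x ^ p) := by nlinarith

/-- Uniform bound for the Beta function `Γ(u)Γ(v)/Γ(u+v)` in vertical strips. -/
theorem exists_norm_Gamma_mul_Gamma_div_Gamma_le {a c : ℝ} (ha : 0 < a) (hc : 0 < c)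
    (hac : 1 / 2 < a + c) :
    ∃ C, 0 < C ∧ ∀ b t : ℝ,
      ‖Gamma (a + b * I) * Gamma (c + t * I) / Gamma ((a + c : ℝ) + (b + t : ℝ) * I)‖ ≤
        C * ((1 + |t|) ^ (c - 1 / 2) / (1 + |b|) ^ c) := by
  obtain ⟨K₁, h₁⟩ := exists_abs_logStirlingError_le ha
  obtain ⟨K₂, h₂⟩ := exists_abs_logStirlingError_le hc
  obtain ⟨K₃, h₃⟩ := exists_abs_logStirlingError_le (add_pos ha hc)
  obtain ⟨K, hK⟩ := exists_mul_log_one_add_abs_sub_le (sub_pos.mpr hac)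
  refine ⟨Real.exp (K + K₁ + K₂ + K₃), Real.exp_pos _, fun b t => ?_⟩
  have n₁ := norm_pos_iff.mpr (Gamma_ofReal_add_mul_I_ne_zero b ha)
  have n₂ := norm_pos_iff.mpr (Gamma_ofReal_add_mul_I_ne_zero t hc)
  have n₃ := norm_pos_iff.mpr (Gamma_ofReal_add_mul_I_ne_zero (b + t) (add_pos ha hc))
  have e₁ := (abs_le.mp (h₁ b)).2
  have e₂ := (abs_le.mp (h₂ t)).2
  have e₃ := (abs_le.mp (h₃ (b + t))).1
  simp only [logStirlingError] at e₁ e₂ e₃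
  rw [norm_div, norm_mul]
  refine (Real.log_le_log_iff (by positivity) (by positivity)).mp ?_
  rw [Real.log_div (by positivity) n₃.ne', Real.log_mul n₁.ne' n₂.ne',
    Real.log_mul (by positivity) (by positivity), Real.log_exp,
    Real.log_div (by positivity) (by positivity), Real.log_rpow (by positivity),
    Real.log_rpow (by positivity)]
  linarith [hK b t]

/-- Stirling-type bound in vertical strips:
`Γ(β/2)Γ(γ/2+1)/Γ((β+γ)/2+1) ≪_{σ_B,σ_C} (1 + |τ_C|^{(1+σ_C)/2})/|τ_B|^{1+σ_C/2}`. -/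
theorem gamma_ratio_bound (σB σC : ℝ) (hB : 0 < σB) (hC : 0 < σC) :
    ∃ C : ℝ, ∀ τB τC : ℝ, 1 < |τB| →
      ‖Complex.Gamma ((σB + τB * Complex.I) / 2) *
          Complex.Gamma ((σC + τC * Complex.I) / 2 + 1) /
          Complex.Gamma (((σB + τB * Complex.I) + (σC + τC * Complex.I)) / 2 + 1)‖ ≤
        C * (1 + |τC| ^ ((1 + σC) / 2)) / |τB| ^ (1 + σC / 2) := by
  obtain ⟨C, hC₀, hbound⟩ := exists_norm_Gamma_mul_Gamma_div_Gamma_le (half_pos hB)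
    (show 0 < 1 + σC / 2 by positivity) (by linarith)
  refine ⟨C * 2 ^ ((1 + σC) / 2) * 2 ^ (1 + σC / 2), fun τB τC hτ => ?_⟩
  have h := hbound (τB / 2) (τC / 2)
  have hβ : ((σB / 2 : ℝ) : ℂ) + (τB / 2 : ℝ) * I = (σB + τB * I) / 2 := by
    push_cast
    ring
  have hγ : ((1 + σC / 2 : ℝ) : ℂ) + (τC / 2 : ℝ) * I = (σC + τC * I) / 2 + 1 := by
    push_cast
    ring
  have hβγ : ((σB / 2 + (1 + σC / 2) : ℝ) : ℂ) + (τB / 2 + τC / 2 : ℝ) * I =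
      ((σB + τB * I) + (σC + τC * I)) / 2 + 1 := by
    push_cast
    ring
  rw [hβ, hγ, hβγ, show 1 + σC / 2 - 1 / 2 = (1 + σC) / 2 by ring] at h
  have hnum : (1 + |τC / 2|) ^ ((1 + σC) / 2) ≤
      2 ^ ((1 + σC) / 2) * (1 + |τC| ^ ((1 + σC) / 2)) := by
    refine le_trans ?_ (one_add_rpow_le (abs_nonneg τC) (by positivity))
    refine Real.rpow_le_rpow (by positivity) ?_ (by positivity)
    rw [abs_div, abs_two]
    linarith [abs_nonneg τC]
  have hτ₀ : 0 < |τB| := one_pos.trans hτ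
  have hden : |τB| ^ (1 + σC / 2) / 2 ^ (1 + σC / 2) ≤ (1 + |τB / 2|) ^ (1 + σC / 2) := by
    rw [← Real.div_rpow hτ₀.le two_pos.le, abs_div, abs_two]
    exact Real.rpow_le_rpow (by positivity) (by linarith) (by positivity)
  calc _ ≤ C * ((1 + |τC / 2|) ^ ((1 + σC) / 2) / (1 + |τB / 2|) ^ (1 + σC / 2)) := h
    _ ≤ C * (2 ^ ((1 + σC) / 2) * (1 + |τC| ^ ((1 + σC) / 2)) /
        (|τB| ^ (1 + σC / 2) / 2 ^ (1 + σC / 2))) := by gcongr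
    _ = _ := by field_simp
end
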